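/- arXiv:2103.13880 — 7 statements merged into one kernel-verified Lean document; each statement's English description precedes it below -/
import Mathlib

section
/- Let F be a field and suppose f ∈ F[x] has degree m and factors completely over an extension field E of F, with t distinct zeros α_1, …, α_t ∈ E, all nonzero, where α_i has multiplicity e_i (so e_1 + ⋯ + e_t = m). Then a sequence s : ℤ → E satisfies f(σ)s = 0 if and only if there exist coefficients c_{i,j} ∈ E (1 ≤ i ≤ t, 0 ≤ j ≤ e_i − 1) such that s_n = Σ_{i=1}^t α_i^n · Σ_{j=0}^{e_i−1} c_{i,j}·C(n, j) for all n ∈ ℤ, where C(n, j) = n(n−1)⋯(n−j+1)/j! ∈ ℤ is the binomial coefficient extended to integer upper argument n, mapped into E via the canonical ring homomorphism ℤ → E. -/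
open Polynomial

/-- `lrsApply f s` is the sequence `f(σ)s`, where `σ` is the left-shift operator:
`(f(σ)s)_n = ∑_i (coeff of x^i in f) * s_{n+i}`. -/
noncomputable def lrsApply {F : Type*} [CommRing F] (f : Polynomial F) (s : ℤ → F) : ℤ → F :=
  fun n => ∑ i ∈ Finset.range (f.natDegree + 1), f.coeff i * s (n + i)

/-- The left shift on two-way infinite sequences, as a linear map. -/
noncomputable def leftShift (E : Type*) [Field E] : (ℤ → E) →ₗ[E] (ℤ → E) :=
  LinearMap.funLeft E E (· + 1)

theorem leftShift_pow_apply {E : Type*} [Field E] (i : ℕ) (s : ℤ → E) (n : ℤ) :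
    (leftShift E ^ i) s n = s (n + i) := by
  induction i generalizing n with
  | zero => simp
  | succ i ih =>
    rw [pow_succ', Module.End.mul_apply, leftShift, LinearMap.funLeft_apply, ← leftShift, ih]
    congr 1
    push_cast
    ring

theorem lrsApply_eq_aeval_leftShift {E : Type*} [Field E] (f : E[X]) (s : ℤ → E) :
    lrsApply f s = aeval (leftShift E) f s := by
  funext n
  simp [lrsApply, aeval_eq_sum_range, LinearMap.sum_apply, leftShift_pow_apply]

theorem aeval_leftShift_X_sub_C_apply {E : Type*} [Field E] (a : E) (s : ℤ → E) (n : ℤ) :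
    aeval (leftShift E) (X - C a) s n = s (n + 1) - a * s n := by
  simp [leftShift, LinearMap.funLeft_apply, Module.algebraMap_end_apply]

/-- The sequence `n ↦ a ^ n * C(n, j)`. -/
noncomputable def binomialExp {E : Type*} [Field E] (a : E) (j : ℕ) : ℤ → E :=
  fun n => a ^ n * ((Ring.choose n j : ℤ) : E)

theorem aeval_leftShift_binomialExp_zero {E : Type*} [Field E] {a : E} (ha : a ≠ 0) :
    aeval (leftShift E) (X - C a) (binomialExp a 0) = 0 := by
  funext n
  rw [aeval_leftShift_X_sub_C_apply]
  simp [binomialExp, zpow_add_one₀ ha, mul_comm]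

theorem aeval_leftShift_binomialExp_succ {E : Type*} [Field E] {a : E} (ha : a ≠ 0) (j : ℕ) :
    aeval (leftShift E) (X - C a) (binomialExp a (j + 1)) = a • binomialExp a j := by
  funext n
  rw [aeval_leftShift_X_sub_C_apply]
  simp only [binomialExp, zpow_add_one₀ ha, Ring.choose_succ_succ, Pi.smul_apply, smul_eq_mul]
  push_cast
  ring

theorem eq_smul_binomialExp_zero {E : Type*} [Field E] {a : E} (ha : a ≠ 0) {s : ℤ → E}
    (hs : aeval (leftShift E) (X - C a) s = 0) : s = s 0 • binomialExp a 0 := by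
  have h (n : ℤ) : s (n + 1) = a * s n := by
    have := congrFun hs n
    rwa [aeval_leftShift_X_sub_C_apply, Pi.zero_apply, sub_eq_zero] at this
  funext n
  simp only [binomialExp, Pi.smul_apply, smul_eq_mul, Ring.choose_zero_right, Int.cast_one, mul_one]
  induction n using Int.induction_on with
  | zero => simp
  | succ n ih => rw [h, ih, zpow_add_one₀ ha]; ring
  | pred n ih =>
    have := h (-n - 1)
    rw [sub_add_cancel, ih] at this
    apply mul_left_cancel₀ ha
    rw [← this, zpow_sub_one₀ ha]
    field_simp

theorem aeval_leftShift_X_sub_C_pow_eq_zero_iff {E : Type*} [Field E] {a : E} (ha : a ≠ 0) (k : ℕ)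
    (s : ℤ → E) :
    aeval (leftShift E) ((X - C a) ^ k) s = 0 ↔
      ∃ c : ℕ → E, s = ∑ j ∈ Finset.range k, c j • binomialExp a j := by
  induction k generalizing s with
  | zero => simp
  | succ k ih =>
    rw [pow_succ, map_mul, Module.End.mul_apply, ih]
    constructor
    · rintro ⟨c, hc⟩
      have hker : aeval (leftShift E) (X - C a)
          (s - ∑ j ∈ Finset.range k, (c j * a⁻¹) • binomialExp a (j + 1)) = 0 := by
        rw [map_sub, hc, map_sum, sub_eq_zero]
        refine Finset.sum_congr rfl fun j _ => ?_
        rw [map_smul, aeval_leftShift_binomialExp_succ ha, smul_smul, inv_mul_cancel_right₀ ha]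
      have hs := sub_eq_iff_eq_add.mp (eq_smul_binomialExp_zero ha hker)
      rw [add_comm] at hs
      generalize (s - _ : ℤ → E) 0 = d at hs
      refine ⟨fun j => j.casesOn d fun j => c j * a⁻¹, ?_⟩
      rw [Finset.sum_range_succ']
      exact hs
    · rintro ⟨c, rfl⟩
      refine ⟨fun j => c (j + 1) * a, ?_⟩
      simp only [Finset.sum_range_succ', map_add, map_sum, map_smul,
        aeval_leftShift_binomialExp_succ ha, aeval_leftShift_binomialExp_zero ha, smul_smul,
        smul_zero, add_zero]

theorem ker_aeval_prod_eq_iSup {R M ι : Type*} [CommRing R] [AddCommGroup M] [Module R M]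
    (φ : M →ₗ[R] M) (p : ι → R[X]) (s : Finset ι)
    (hp : (s : Set ι).Pairwise (Function.onFun IsCoprime p)) :
    LinearMap.ker (aeval φ (∏ i ∈ s, p i)) = ⨆ i ∈ s, LinearMap.ker (aeval φ (p i)) := by
  classical
  induction s using Finset.induction_on with
  | empty => simp [Module.End.one_eq_id]
  | insert i s hi ih =>
    rw [Finset.prod_insert hi, Finset.iSup_insert,
      ← ih (hp.mono (Finset.coe_subset.mpr (Finset.subset_insert i s))),
      sup_ker_aeval_eq_ker_aeval_mul_of_coprime]
    refine IsCoprime.prod_right fun j hj => hp (by simp) (by simp [hj]) ?_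
    rintro rfl
    exact hi hj

/-- General solution of a linear recurrence: if `f ∈ F[x]` factors completely over an
extension `E` with distinct nonzero zeros `α_1, …, α_t`, where `α_i` has multiplicity `e_i`,
then the `f`-sequences over `E` are exactly the sequences
`s_n = ∑_i α_i^n ∑_{j<e_i} c_{i,j} C(n,j)`, with `C(n,j)` the binomial coefficient
extended to integer upper argument `n`. -/
theorem fSequence_iff_binomial_exponential_form {F E : Type*} [Field F] [Field E] [Algebra F E]
    (f : Polynomial F) (t : ℕ) (α : Fin t → E) (e : Fin t → ℕ) (c₀ : E) (hc₀ : c₀ ≠ 0)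
    (hαinj : Function.Injective α) (hα0 : ∀ i, α i ≠ 0) (he : ∀ i, 1 ≤ e i)
    (hfact : f.map (algebraMap F E) = C c₀ * ∏ i, (X - C (α i)) ^ e i)
    (s : ℤ → E) :
    lrsApply (f.map (algebraMap F E)) s = 0 ↔
      ∃ c : Fin t → ℕ → E, ∀ n : ℤ,
        s n = ∑ i, (α i) ^ n * ∑ j ∈ Finset.range (e i), c i j * ((Ring.choose n j : ℤ) : E) := by
  have hcop : ((Finset.univ : Finset (Fin t)) : Set (Fin t)).Pairwise
      (Function.onFun IsCoprime fun i => (X - C (α i)) ^ e i) :=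
    fun i _ j _ hij => (pairwise_coprime_X_sub_C hαinj hij).pow
  have hform (c : Fin t → ℕ → E) :
      (∀ n : ℤ, s n =
        ∑ i, (α i) ^ n * ∑ j ∈ Finset.range (e i), c i j * ((Ring.choose n j : ℤ) : E)) ↔
      ∑ i, ∑ j ∈ Finset.range (e i), c i j • binomialExp (α i) j = s := by
    rw [eq_comm, funext_iff]
    refine forall_congr' fun n => ?_
    simp only [Finset.sum_apply, Pi.smul_apply, smul_eq_mul, binomialExp, Finset.mul_sum,
      mul_left_comm]
  simp only [hform]
  rw [lrsApply_eq_aeval_leftShift, hfact, map_mul, Module.End.mul_apply, aeval_C,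
    Module.algebraMap_end_apply, smul_eq_zero_iff_right hc₀, ← LinearMap.mem_ker,
    ker_aeval_prod_eq_iSup _ _ _ hcop, Submodule.mem_iSup_finset_iff_exists_sum]
  constructor
  · rintro ⟨μ, hμ⟩
    choose c hc using fun i =>
      (aeval_leftShift_X_sub_C_pow_eq_zero_iff (hα0 i) (e i) _).mp (LinearMap.mem_ker.mp (μ i).2)
    exact ⟨c, by rw [← hμ]; exact Finset.sum_congr rfl fun i _ => (hc i).symm⟩
  · rintro ⟨c, hc⟩
    exact ⟨fun i => ⟨_, LinearMap.mem_ker.mpr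
      ((aeval_leftShift_X_sub_C_pow_eq_zero_iff (hα0 i) (e i) _).mpr ⟨c i, rfl⟩)⟩, hc⟩
end

section
/- Let F be a field and let s : ℤ → F be a periodic sequence with period m ≥ 1 (s_{n+m} = s_n for all n ∈ ℤ). Then the minimal recursion of s equals f_s(x) = (x^m − 1)/gcd(x^m − 1, s̃(x)), where the gcd is taken monic in F[x]; in particular f_s ∈ F[x]. -/
open Polynomial

/-- The associated polynomial `t_0 x^{m-1} + ⋯ + t_{m-1}` of a sequence `t`, as a linear map. -/
noncomputable def associatedPolynomial (R : Type*) [CommRing R] (m : ℕ) : (ℤ → R) →ₗ[R] R[X] where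
  toFun t := ∑ i ∈ Finset.range m, C (t i) * X ^ (m - 1 - i)
  map_add' t u := by simp [add_mul, Finset.sum_add_distrib]
  map_smul' c t := by simp [Finset.smul_sum, smul_eq_C_mul, mul_assoc]

section CommRing

variable {R : Type*} [CommRing R]

theorem associatedPolynomial_apply (m : ℕ) (t : ℤ → R) :
    associatedPolynomial R m t = ∑ i ∈ Finset.range m, C (t i) * X ^ (m - 1 - i) := rfl

theorem coeff_associatedPolynomial {m i : ℕ} (hi : i < m) (t : ℤ → R) :
    (associatedPolynomial R m t).coeff (m - 1 - i) = t i := by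
  rw [associatedPolynomial_apply, finsetSum_coeff, Finset.sum_eq_single i]
  · simp
  · intro j hj hji
    have := Finset.mem_range.mp hj
    rw [coeff_C_mul_X_pow, if_neg (by lia)]
  · simp [hi]

theorem degree_associatedPolynomial_lt {m : ℕ} (hm : 1 ≤ m) (t : ℤ → R) :
    (associatedPolynomial R m t).degree < m := by
  rw [associatedPolynomial_apply]
  rw [← mem_degreeLT]
  refine Submodule.sum_mem _ fun i _ => mem_degreeLT.mpr ?_
  refine (degree_C_mul_X_pow_le _ _).trans_lt ?_
  exact_mod_cast (by lia : m - 1 - i < m)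

theorem X_mul_associatedPolynomial {m : ℕ} {t : ℤ → R} (ht : ∀ n : ℤ, t (n + m) = t n) :
    X * associatedPolynomial R m t =
      associatedPolynomial R m (fun n => t (n + 1)) + C (t 0) * (X ^ m - 1) := by
  rcases m with _ | k
  · simp [associatedPolynomial_apply]
  have hlast : t (k + 1) = t 0 := by simpa using ht 0
  rw [associatedPolynomial_apply, associatedPolynomial_apply, Finset.sum_range_succ',
    Finset.sum_range_succ, mul_add, Finset.mul_sum]
  have hsum : ∑ i ∈ Finset.range k, X * (C (t ↑(i + 1)) * X ^ (k + 1 - 1 - (i + 1))) =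
      ∑ i ∈ Finset.range k, C (t (i + 1)) * X ^ (k + 1 - 1 - i) := by
    refine Finset.sum_congr rfl fun i hi => ?_
    have hi := Finset.mem_range.mp hi
    rw [show k + 1 - 1 - i = k + 1 - 1 - (i + 1) + 1 by lia, pow_succ]
    push_cast
    ring
  rw [hsum, hlast]
  simp
  ring

theorem dvd_X_pow_mul_associatedPolynomial_sub {m : ℕ} {t : ℤ → R}
    (ht : ∀ n : ℤ, t (n + m) = t n) (k : ℕ) :
    X ^ m - 1 ∣ X ^ k * associatedPolynomial R m t -
      associatedPolynomial R m (fun n => t (n + k)) := by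
  induction k with
  | zero => simp
  | succ k ih =>
    have hk : ∀ n : ℤ, t (n + m + k) = t (n + k) := fun n => by rw [add_right_comm, ht]
    have h := X_mul_associatedPolynomial (t := fun n => t (n + k)) hk
    have hshift : (fun n : ℤ => t (n + 1 + k)) = fun n : ℤ => t (n + (k + 1 : ℕ)) := by
      funext n
      congr 1
      push_cast
      ring
    rw [hshift] at h
    have hdvd := dvd_add (ih.mul_left X) (Dvd.intro_left (C (t (0 + k))) rfl)
    convert hdvd using 1
    linear_combination h

theorem lrsApply_eq_sum_smul (g : R[X]) (t : ℤ → R) :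
    lrsApply g t = ∑ i ∈ Finset.range (g.natDegree + 1), g.coeff i • fun n : ℤ => t (n + i) := by
  funext n
  simp [lrsApply]

theorem dvd_mul_associatedPolynomial_sub {m : ℕ} {t : ℤ → R}
    (ht : ∀ n : ℤ, t (n + m) = t n) (g : R[X]) :
    X ^ m - 1 ∣ g * associatedPolynomial R m t - associatedPolynomial R m (lrsApply g t) := by
  rw [lrsApply_eq_sum_smul, map_sum]
  nth_rw 1 [g.as_sum_range_C_mul_X_pow]
  rw [Finset.sum_mul, ← Finset.sum_sub_distrib]
  refine Finset.dvd_sum fun i _ => ?_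
  rw [map_smul, smul_eq_C_mul, mul_assoc, ← mul_sub]
  exact (dvd_X_pow_mul_associatedPolynomial_sub ht i).mul_left _

theorem lrsApply_add_period {m : ℕ} {t : ℤ → R} (ht : ∀ n : ℤ, t (n + m) = t n) (g : R[X])
    (n : ℤ) : lrsApply g t (n + m) = lrsApply g t n := by
  refine Finset.sum_congr rfl fun i _ => ?_
  rw [add_right_comm, ht]

theorem eq_zero_of_associatedPolynomial_eq_zero {m : ℕ} (hm : 1 ≤ m) {t : ℤ → R}
    (ht : ∀ n : ℤ, t (n + m) = t n) (h : associatedPolynomial R m t = 0) : t = 0 := by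
  funext n
  have hpos : (0 : ℤ) < m := by exact_mod_cast hm
  obtain ⟨i, hi⟩ := Int.eq_ofNat_of_zero_le (Int.emod_nonneg n hpos.ne')
  have him : i < m := by
    have := Int.emod_lt_of_pos n hpos
    lia
  have hmod : t (n % m) = t n := by
    rw [Int.emod_def, mul_comm]
    exact Function.Periodic.sub_int_mul_eq ht _
  rw [← hmod, hi, ← coeff_associatedPolynomial him t, h]
  simp

theorem lrsApply_eq_zero_iff {m : ℕ} (hm : 1 ≤ m) {t : ℤ → R}
    (ht : ∀ n : ℤ, t (n + m) = t n) (g : R[X]) :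
    lrsApply g t = 0 ↔ X ^ m - 1 ∣ g * associatedPolynomial R m t := by
  have hdvd := dvd_mul_associatedPolynomial_sub ht g
  constructor
  · intro h
    simpa [h] using hdvd
  · intro h
    nontriviality R
    refine eq_zero_of_associatedPolynomial_eq_zero hm (lrsApply_add_period ht g) ?_
    have hmonic : (X ^ m - 1 : R[X]).Monic := monic_X_pow_sub_C 1 (by lia)
    by_contra hne
    refine hmonic.not_dvd_of_degree_lt hne ?_ ((dvd_sub_right h).mp hdvd)
    have hdeg : (X ^ m - 1 : R[X]).degree = m := degree_X_pow_sub_C hm 1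
    rw [hdeg]
    exact degree_associatedPolynomial_lt hm _

end CommRing

/-- If `s` is periodic with period `m ≥ 1` over a field `F`, then its minimal recursion is
`f_s(x) = (x^m - 1) / gcd(x^m - 1, s̃(x))`, where `s̃(x) = s_0 x^{m-1} + ⋯ + s_{m-1}` and the
gcd is taken monic in `F[x]` (here `d` is hypothesized to be this monic gcd):
`f_s` is monic and, for every `g ∈ F[x]`, `g(σ)s = 0` iff `f_s ∣ g`. -/
theorem minimal_recursion_of_periodic_sequence {F : Type*} [Field F] (m : ℕ) (hm : 1 ≤ m)
    (s : ℤ → F) (hper : ∀ n : ℤ, s (n + m) = s n)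
    (d : Polynomial F) (hd : d.Monic)
    (hd1 : d ∣ X ^ m - 1) (hd2 : d ∣ ∑ i ∈ Finset.range m, C (s i) * X ^ (m - 1 - i))
    (hdgcd : ∀ e : Polynomial F,
      e ∣ X ^ m - 1 → e ∣ (∑ i ∈ Finset.range m, C (s i) * X ^ (m - 1 - i)) → e ∣ d) :
    ((X ^ m - 1) / d : Polynomial F).Monic ∧
    ∀ g : Polynomial F, lrsApply g s = 0 ↔ ((X ^ m - 1) / d : Polynomial F) ∣ g := by
  have hmonic : (X ^ m - 1 : F[X]).Monic := monic_X_pow_sub_C 1 (by lia)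
  obtain ⟨q, hq⟩ := hd1
  obtain ⟨r, hr⟩ := hd2
  rw [hq, mul_div_cancel_left₀ q hd.ne_zero]
  rw [hq] at hmonic
  refine ⟨hd.of_mul_monic_left hmonic, fun g => ?_⟩
  have hrel : IsRelPrime q r := fun e heq her => by
    have hde : d * e ∣ d * 1 := by
      rw [mul_one]
      apply hdgcd
      · rw [hq]
        exact mul_dvd_mul_left d heq
      · rw [hr]
        exact mul_dvd_mul_left d her
    exact isUnit_of_dvd_one ((mul_dvd_mul_iff_left hd.ne_zero).mp hde)
  rw [lrsApply_eq_zero_iff hm hper, associatedPolynomial_apply, hr, hq, mul_left_comm,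
    mul_dvd_mul_iff_left hd.ne_zero]
  exact ⟨hrel.isCoprime.dvd_of_dvd_mul_right, fun h => h.mul_right r⟩
end

section
/- Let F be a field of characteristic p, let f(x) = ∏_{i=1}^t (x − α_i)^{e_i} ∈ F[x] have distinct nonzero zeros α_1, …, α_t in an extension E of F, and let s : ℤ → F be a nonzero f-sequence of period m, where gcd(m, p) = 1 if p > 0. Let J = {i ∈ {1, …, t} | α_i^m = 1}. Then there exist c_i ∈ E (i ∈ J) such that s_n = Σ_{i∈J} c_i α_i^n for all n ∈ ℤ, and the minimal recursion of s is f_s(x) = ∏_{i∈J, c_i≠0} (x − α_i). -/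
open Polynomial
open scoped Classical

/-- The left-shift operator on bi-infinite sequences. -/
def shiftEnd (K : Type*) [CommRing K] : Module.End K (ℤ → K) :=
  LinearMap.funLeft K K (· + 1)

theorem shiftEnd_pow_apply {K : Type*} [CommRing K] (k : ℕ) (s : ℤ → K) (n : ℤ) :
    (shiftEnd K ^ k) s n = s (n + k) := by
  induction k generalizing n with
  | zero => simp
  | succ k ih =>
    rw [pow_succ', Module.End.mul_apply]
    simp only [shiftEnd, LinearMap.funLeft_apply] at ih ⊢
    rw [ih]
    push_cast
    ring_nf

theorem lrsApply_eq_aeval {K : Type*} [CommRing K] (g : K[X]) (s : ℤ → K) :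
    lrsApply g s = aeval (shiftEnd K) g s := by
  ext n
  simp [lrsApply, aeval_eq_sum_range, LinearMap.sum_apply, shiftEnd_pow_apply]

theorem lrsApply_eq_sum_range {K : Type*} [CommRing K] (g : K[X]) (s : ℤ → K) {N : ℕ}
    (hN : g.natDegree < N) (n : ℤ) :
    lrsApply g s n = ∑ i ∈ Finset.range N, g.coeff i * s (n + i) := by
  refine Finset.sum_subset (Finset.range_mono hN) fun i _ hi => ?_
  rw [coeff_eq_zero_of_natDegree_lt (by simpa using hi), zero_mul]

theorem lrsApply_X_sub_C {K : Type*} [CommRing K] (a : K) (s : ℤ → K) (n : ℤ) :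
    lrsApply (X - C a) s n = s (n + 1) - a * s n := by
  simp [lrsApply_eq_aeval, shiftEnd, LinearMap.funLeft_apply]

theorem lrsApply_X_pow_sub_one {K : Type*} [CommRing K] (m : ℕ) (s : ℤ → K) (n : ℤ) :
    lrsApply (X ^ m - 1) s n = s (n + m) - s n := by
  simp [lrsApply_eq_aeval, shiftEnd_pow_apply]

theorem lrsApply_mul {K : Type*} [CommRing K] (g h : K[X]) (s : ℤ → K) :
    lrsApply (g * h) s = lrsApply g (lrsApply h s) := by
  simp [lrsApply_eq_aeval]

theorem lrsApply_zero_right {K : Type*} [CommRing K] (g : K[X]) :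
    lrsApply g (0 : ℤ → K) = 0 := by
  simp [lrsApply_eq_aeval]

theorem lrsApply_map {F E : Type*} [Field F] [Field E] [Algebra F E] (g : F[X]) (s : ℤ → F) :
    lrsApply (g.map (algebraMap F E)) (fun n => algebraMap F E (s n)) =
      fun n => algebraMap F E (lrsApply g s n) := by
  ext n
  simp [lrsApply]

/-- A nonzero recursion over an extension field yields a nonzero recursion over the base field
of the same degree. -/
theorem exists_lrsApply_eq_zero_of_extension {F E : Type*} [Field F] [Field E] [Algebra F E]
    {s : ℤ → F} {g : E[X]} (hg : g ≠ 0)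
    (h : lrsApply g (fun n => algebraMap F E (s n)) = 0) :
    ∃ g' : F[X], g' ≠ 0 ∧ g'.natDegree ≤ g.natDegree ∧ lrsApply g' s = 0 := by
  obtain ⟨φ, hφ⟩ : ∃ φ : Module.Dual F E, φ g.leadingCoeff ≠ 0 :=
    Module.Projective.exists_dual_ne_zero F (leadingCoeff_ne_zero.2 hg)
  set g' : F[X] := ∑ i ∈ Finset.range (g.natDegree + 1), monomial i (φ (g.coeff i)) with hg'
  have hcoeff (i : ℕ) : g'.coeff i = φ (g.coeff i) := by
    simp only [hg', finsetSum_coeff, coeff_monomial, Finset.sum_ite_eq', Finset.mem_range]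
    split_ifs with hi
    · rfl
    · rw [coeff_eq_zero_of_natDegree_lt (by omega), map_zero]
  have hdeg : g'.natDegree ≤ g.natDegree := natDegree_le_iff_coeff_eq_zero.2 fun i hi => by
    rw [hcoeff, coeff_eq_zero_of_natDegree_lt hi, map_zero]
  refine ⟨g', fun h0 => hφ ?_, hdeg, ?_⟩
  · rw [leadingCoeff, ← hcoeff, h0, coeff_zero]
  · ext n
    have := congrArg φ (congrFun h n)
    rw [lrsApply_eq_sum_range g' s (Nat.lt_succ_of_le hdeg)]
    simpa [lrsApply, hcoeff, mul_comm _ (algebraMap F E _), ← Algebra.smul_def,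
      mul_comm (s _)] using this

theorem eq_mul_zpow_of_lrsApply_X_sub_C {K : Type*} [Field K] {a : K} (ha : a ≠ 0) {s : ℤ → K}
    (h : lrsApply (X - C a) s = 0) (n : ℤ) : s n = s 0 * a ^ n := by
  have hstep (k : ℤ) : s (k + 1) = a * s k := by
    have := congrFun h k
    rwa [lrsApply_X_sub_C, Pi.zero_apply, sub_eq_zero] at this
  induction n using Int.induction_on with
  | zero => simp
  | succ k ih => rw [hstep, ih, zpow_add_one₀ ha]; ring
  | pred k ih =>
    have := hstep (-k - 1)
    rw [sub_add_cancel, ih] at this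
    rw [zpow_sub_one₀ ha]
    field_simp
    linear_combination -this

/-- A sequence annihilated by a product of distinct linear factors is a combination of
geometric sequences. -/
theorem exists_eq_sum_zpow_of_lrsApply_prod {K ι : Type*} [Field K] {I : Finset ι}
    (hI : I.Nonempty) {α : ι → K} (hinj : Set.InjOn α I) (h0 : ∀ i ∈ I, α i ≠ 0) {s : ℤ → K}
    (h : lrsApply (∏ i ∈ I, (X - C (α i))) s = 0) :
    ∃ c : ι → K, ∀ n : ℤ, s n = ∑ i ∈ I, c i * α i ^ n := by
  refine ⟨fun i => lrsApply (Lagrange.basis I α i) s 0, fun n => ?_⟩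
  have hsum : s = ∑ i ∈ I, lrsApply (Lagrange.basis I α i) s := by
    have := congrArg (fun g => lrsApply g s) (Lagrange.sum_basis hinj hI)
    simpa [lrsApply_eq_aeval, LinearMap.sum_apply] using this.symm
  conv_lhs => rw [hsum, Finset.sum_apply]
  refine Finset.sum_congr rfl fun i hi => eq_mul_zpow_of_lrsApply_X_sub_C (h0 i hi) ?_ n
  have hdvd : (X - C (α i)) * Lagrange.basis I α i =
      C (∏ j ∈ I.erase i, (α i - α j)⁻¹) * ∏ j ∈ I, (X - C (α j)) := by
    rw [← Finset.mul_prod_erase I _ hi]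
    simp only [Lagrange.basis, Lagrange.basisDivisor, Finset.prod_mul_distrib, map_prod]
    ring
  rw [← lrsApply_mul, hdvd, lrsApply_mul, h, lrsApply_zero_right]

theorem lrsApply_prod_sum_zpow {K ι : Type*} [Field K] {I : Finset ι} {α : ι → K}
    (h0 : ∀ i ∈ I, α i ≠ 0) (c : ι → K) :
    lrsApply (∏ i ∈ I, (X - C (α i))) (fun n : ℤ => ∑ i ∈ I, c i * α i ^ n) = 0 := by
  have hs : (fun n : ℤ => ∑ i ∈ I, c i * α i ^ n) = ∑ i ∈ I, fun n : ℤ => c i * α i ^ n := by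
    ext n
    simp
  rw [hs, lrsApply_eq_aeval, map_sum]
  refine Finset.sum_eq_zero fun i hi => ?_
  rw [← lrsApply_eq_aeval, ← Finset.prod_erase_mul I _ hi, lrsApply_mul]
  suffices h : lrsApply (X - C (α i)) (fun n : ℤ => c i * α i ^ n) = 0 by
    rw [h, lrsApply_zero_right]
  ext n
  rw [lrsApply_X_sub_C, zpow_add_one₀ (h0 i hi), Pi.zero_apply]
  ring

/-- A separable monic divisor of `∏ (x - α_i)^{e_i}` is the product of the `x - α_i` over its
own zeros. -/
theorem eq_prod_filter_of_separable_of_dvd {K ι : Type*} [Field K] [Fintype ι] {α : ι → K}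
    (hinj : Function.Injective α) {e : ι → ℕ} {g : K[X]} (hg : g.Monic) (hsep : g.Separable)
    (hdvd : g ∣ ∏ i, (X - C (α i)) ^ e i) :
    g = ∏ i ∈ Finset.univ.filter (fun i => g.IsRoot (α i)), (X - C (α i)) := by
  have hne : ∏ i, (X - C (α i)) ^ e i ≠ 0 :=
    Finset.prod_ne_zero_iff.2 fun i _ => pow_ne_zero _ (X_sub_C_ne_zero _)
  have hsplit : g.Splits :=
    Splits.of_dvd (Splits.prod fun i _ => (Splits.X_sub_C _).pow _) hne hdvd
  have hroots : g.roots =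
      ((Finset.univ.filter (fun i => g.IsRoot (α i))).image α).val := by
    refine (Multiset.Nodup.ext (nodup_roots hsep) (Finset.nodup _)).2 fun a => ?_
    rw [Finset.mem_val, mem_roots hg.ne_zero, Finset.mem_image]
    constructor
    · intro ha
      have := ha.dvd hdvd
      rw [IsRoot, eval_prod, Finset.prod_eq_zero_iff] at this
      obtain ⟨i, -, hi⟩ := this
      have hai : a = α i := by
        have := eq_zero_of_pow_eq_zero (by simpa using hi : (a - α i) ^ e i = 0)
        exact sub_eq_zero.1 this
      exact ⟨i, by simpa [← hai] using ha, hai.symm⟩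
    · rintro ⟨i, hi, rfl⟩
      exact (Finset.mem_filter.1 hi).2
  conv_lhs => rw [hsplit.eq_prod_roots_of_monic hg, hroots]
  exact Finset.prod_image (f := fun a => X - C a) fun i _ j _ hij => hinj hij

theorem natCast_ne_zero_of_coprime_ringChar {F : Type*} [Field F] {m : ℕ} (hm : 0 < m)
    (hchar : ringChar F = 0 ∨ Nat.Coprime m (ringChar F)) : (m : F) ≠ 0 := by
  rw [Ne, ringChar.spec]
  intro h
  rcases hchar with h0 | hc
  · rw [h0, zero_dvd_iff] at h
    omega
  · exact CharP.ringChar_ne_one (hc.symm.eq_one_of_dvd h)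

/-- Let `f = ∏ (x - α_i)^{e_i} ∈ F[x]` with distinct nonzero zeros `α_i` in an extension `E`,
and let `s` be a nonzero `f`-sequence over `F` of period `m`, with `gcd(m, char F) = 1` if
`char F > 0`. With `J = {i | α_i^m = 1}`, there are `c_i ∈ E` (`i ∈ J`) such that
`s_n = ∑_{i ∈ J} c_i α_i^n` for all `n ∈ ℤ`, and the minimal recursion of `s` is
`f_s = ∏_{i ∈ J, c_i ≠ 0} (x - α_i)`. -/
theorem fSequence_exponential_form_and_minimal_recursion {F E : Type*}
    [Field F] [Field E] [Algebra F E]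
    (f : Polynomial F) (t : ℕ) (α : Fin t → E) (e : Fin t → ℕ)
    (hαinj : Function.Injective α) (hα0 : ∀ i, α i ≠ 0) (he : ∀ i, 1 ≤ e i)
    (hfact : f.map (algebraMap F E) = ∏ i, (X - C (α i)) ^ e i)
    (m : ℕ) (hm : 0 < m) (hchar : ringChar F = 0 ∨ Nat.Coprime m (ringChar F))
    (s : ℤ → F) (hs0 : s ≠ 0) (hseq : lrsApply f s = 0) (hper : ∀ n : ℤ, s (n + m) = s n)
    (fs : Polynomial F) (hmonic : fs.Monic)
    (hmin : ∀ g : Polynomial F, lrsApply g s = 0 ↔ fs ∣ g) :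
    ∃ c : Fin t → E,
      (∀ n : ℤ, algebraMap F E (s n) =
        ∑ i ∈ Finset.univ.filter (fun i => α i ^ m = 1), c i * (α i) ^ n) ∧
      fs.map (algebraMap F E) =
        ∏ i ∈ (Finset.univ.filter (fun i => α i ^ m = 1)).filter (fun i => c i ≠ 0),
          (X - C (α i)) := by
  set ι := algebraMap F E
  set g := fs.map ι with hg
  have hgm : g.Monic := hmonic.map ι
  have hdvdm : fs ∣ X ^ m - 1 := (hmin _).1 <| by
    ext n
    rw [lrsApply_X_pow_sub_one, hper, sub_self, Pi.zero_apply]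
  have hsep : g.Separable := Separable.map <| Separable.of_dvd
    (X_pow_sub_one_separable_iff.2 (natCast_ne_zero_of_coprime_ringChar hm hchar)) hdvdm
  have hprod := eq_prod_filter_of_separable_of_dvd hαinj hgm hsep
    (hfact ▸ Polynomial.map_dvd ι ((hmin f).1 hseq))
  set I := Finset.univ.filter (fun i => g.IsRoot (α i)) with hI
  have hIJ : I ⊆ Finset.univ.filter (fun i => α i ^ m = 1) := fun i hi => by
    have := (Finset.mem_filter.1 hi).2.dvd (Polynomial.map_dvd ι hdvdm)
    simpa [sub_eq_zero] using this
  have hgs : lrsApply g (fun n => ι (s n)) = 0 := by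
    rw [hg, lrsApply_map, (hmin fs).2 dvd_rfl]
    ext n
    simp
  have hIne : I.Nonempty := by
    by_contra hempty
    rw [Finset.not_nonempty_iff_eq_empty] at hempty
    rw [hprod, hempty, Finset.prod_empty] at hgs
    refine hs0 (funext fun n => ι.injective ?_)
    simpa [lrsApply] using congrFun hgs n
  obtain ⟨c, hc⟩ := exists_eq_sum_zpow_of_lrsApply_prod hIne hαinj.injOn (fun i _ => hα0 i)
    (hprod ▸ hgs)
  have hcne : ∀ i ∈ I, c i ≠ 0 := fun i hi hci => by
    have hkill : lrsApply (∏ j ∈ I.erase i, (X - C (α j))) (fun n => ι (s n)) = 0 := by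
      rw [← lrsApply_prod_sum_zpow (fun j _ => hα0 j) c]
      congr 1
      ext n
      rw [hc, ← Finset.add_sum_erase I _ hi, hci, zero_mul, zero_add]
    obtain ⟨g', hg'0, hg'deg, hg's⟩ := exists_lrsApply_eq_zero_of_extension
      (Finset.prod_ne_zero_iff.2 fun j _ => X_sub_C_ne_zero (α j)) hkill
    have hle := natDegree_le_of_dvd ((hmin g').1 hg's) hg'0
    rw [← natDegree_map ι, ← hg, hprod, natDegree_finsetProd_X_sub_C_eq_card] at hle
    rw [natDegree_finsetProd_X_sub_C_eq_card, Finset.card_erase_of_mem hi] at hg'deg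
    have := Finset.card_pos.2 hIne
    omega
  refine ⟨fun i => if i ∈ I then c i else 0, fun n => ?_, ?_⟩
  · rw [hc n, ← Finset.sum_subset hIJ fun i _ hi => by simp [hi]]
    exact Finset.sum_congr rfl fun i hi => by simp [hi]
  · conv_lhs => rw [hprod]
    refine Finset.prod_congr (Finset.ext fun i => ?_) fun _ _ => rfl
    by_cases hi : i ∈ I
    · have him := (Finset.mem_filter.1 (hIJ hi)).2
      simp only [Finset.mem_filter, Finset.mem_univ, hi, him, if_true, true_and, true_iff]
      exact hcne i hi
    · simp only [Finset.mem_filter, hi, if_false, ne_eq, not_true_eq_false, and_false]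
end

section
/- Let F be a field and let f ∈ F[x] be a quadratic polynomial with two distinct nonzero zeros a, b ∈ F, i.e., f(x) = (x − a)(x − b) with a ≠ b and ab ≠ 0. If M is an f-subgroup in the multiplicative group of an extension field E of F, then M equals one of the subgroups ⟨a, b⟩, ⟨a⟩, or ⟨b⟩; moreover, if M is a proper subgroup of ⟨a, b⟩, then every f-sequence presenting M is cyclic, so M is a standard f-subgroup. -/
open Polynomial

theorem eq_zpow_mul_of_succ_eq_mul {E : Type*} [Field E] {c : E} (hc : c ≠ 0) {u : ℤ → E}
    (h : ∀ n, u (n + 1) = c * u n) (n : ℤ) : u n = c ^ n * u 0 := by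
  induction n using Int.induction_on with
  | zero => simp
  | succ i ih => rw [h, ih, zpow_add_one₀ hc]; ring
  | pred i ih =>
    have h' := h (-i - 1)
    rw [sub_add_cancel, ih] at h'
    apply mul_left_cancel₀ hc
    rw [← h', ← mul_assoc, ← zpow_one_add₀ hc]
    congr 2
    ring

theorem add_two_eq_of_lrsApply_eq_zero {E : Type*} [Field E] {a b : E} {s : ℤ → E}
    (h : lrsApply ((X - C a) * (X - C b)) s = 0) (n : ℤ) :
    s (n + 2) = (a + b) * s (n + 1) - a * b * s n := by
  have hdeg : ((X - C a) * (X - C b)).natDegree = 2 := by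
    rw [natDegree_mul (X_sub_C_ne_zero a) (X_sub_C_ne_zero b)]
    simp
  have hexp : (X - C a) * (X - C b) = X ^ 2 - C (a + b) * X + C (a * b) := by
    simp only [C_add, C_mul]
    ring
  have hn := congrFun h n
  rw [lrsApply, hdeg, hexp] at hn
  simp [Finset.sum_range_succ, coeff_X, coeff_C, -map_add, -map_mul] at hn
  linear_combination hn

theorem geometric_or_pow_eq_one_of_lrsApply_eq_zero {E : Type*} [Field E] {a b : E} (ha : a ≠ 0)
    (hb : b ≠ 0) (hab : a ≠ b) {s : ℤ → E} (h : lrsApply ((X - C a) * (X - C b)) s = 0) {m : ℕ}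
    (hper : ∀ n : ℤ, s (n + m) = s n) :
    (∀ n, s (n + 1) = a * s n) ∨ (∀ n, s (n + 1) = b * s n) ∨
      (a ^ m = 1 ∧ b ^ m = 1 ∧ ∀ d : ℕ, a ^ d = 1 → b ^ d = 1 → s d = s 0) := by
  have hrec := add_two_eq_of_lrsApply_eq_zero h
  have hu := eq_zpow_mul_of_succ_eq_mul ha (u := fun n => s (n + 1) - b * s n) fun n => by
    rw [add_assoc, one_add_one_eq_two, hrec]; ring
  have hv := eq_zpow_mul_of_succ_eq_mul hb (u := fun n => s (n + 1) - a * s n) fun n => by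
    rw [add_assoc, one_add_one_eq_two, hrec]; ring
  simp only [zero_add] at hu hv
  by_cases hv0 : s 1 - a * s 0 = 0
  · exact .inl fun n => by simpa [hv0, sub_eq_zero] using hv n
  by_cases hu0 : s 1 - b * s 0 = 0
  · exact .inr <| .inl fun n => by simpa [hu0, sub_eq_zero] using hu n
  have hm0 : s m = s 0 := by simpa using hper 0
  have hm1 : s (m + 1) = s 1 := by simpa [add_comm] using hper 1
  refine .inr <| .inr ⟨?_, ?_, fun d had hbd => ?_⟩
  · simpa [hm0, hm1, hu0] using (hu m).symm
  · simpa [hm0, hm1, hv0] using (hv m).symm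
  · have hud := hu d
    have hvd := hv d
    rw [zpow_natCast, had] at hud
    rw [zpow_natCast, hbd] at hvd
    exact mul_left_cancel₀ (sub_ne_zero.mpr hab) (by linear_combination hud - hvd)

theorem Subgroup.pow_natCard_eq_one_of_mem {G : Type*} [Group G] {H : Subgroup G} {x : G}
    (hx : x ∈ H) : x ^ Nat.card H = 1 :=
  congrArg Subtype.val (pow_card_eq_one' (x := (⟨x, hx⟩ : H)))

theorem Subgroup.mem_of_pow_card_eq_one {E : Type*} [Field E] {M : Subgroup Eˣ} {m : ℕ}
    (hm : 0 < m) (hcard : Nat.card M = m) {x : Eˣ} (hx : x ^ m = 1) : x ∈ M := by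
  have : NeZero m := ⟨hm.ne'⟩
  have hle : M ≤ rootsOfUnity m E := fun y hy => by
    rw [mem_rootsOfUnity, ← hcard]
    exact Subgroup.pow_natCard_eq_one_of_mem hy
  have heq : M = rootsOfUnity m E := Subgroup.eq_of_le_of_card_ge hle <| by
    rw [hcard]
    exact card_rootsOfUnity E m
  rw [heq]
  exact hx

theorem Subgroup.eq_closure_of_injective {G α : Type*} [Group G] {M : Subgroup G} {m : ℕ}
    (hm : 0 < m) (hcard : Nat.card M = m) {s : ℤ → α}
    (hinj : Function.Injective fun i : Fin m => s ((i : ℕ) : ℤ)) {S : Set G}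
    (hS : S ⊆ M) (hs : ∀ d : ℕ, (∀ x ∈ S, x ^ d = 1) → s d = s 0) :
    M = Subgroup.closure S := by
  have hle : Subgroup.closure S ≤ M := (Subgroup.closure_le M).mpr hS
  have : Finite M := Nat.finite_of_card_ne_zero (by omega)
  have : Finite (Subgroup.closure S) := Finite.Set.subset (M : Set G) hle
  refine (Subgroup.eq_of_le_of_card_ge hle ?_).symm
  rw [hcard]
  by_contra! hlt
  have hd := hs (Nat.card (Subgroup.closure S)) fun x hx =>
    Subgroup.pow_natCard_eq_one_of_mem (Subgroup.subset_closure hx)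
  have h0 : (⟨_, hlt⟩ : Fin m) = ⟨0, hm⟩ := hinj (by simpa using hd)
  exact Nat.card_pos.ne' (Fin.mk.inj h0)

theorem Subgroup.eq_closure_singleton_of_geometric {E : Type*} [Field E] {M : Subgroup Eˣ} {m : ℕ}
    (hm : 0 < m) (hcard : Nat.card M = m) {s : ℤ → E} (hs0 : s 0 ≠ 0)
    (hper : ∀ n : ℤ, s (n + m) = s n)
    (hinj : Function.Injective fun i : Fin m => s ((i : ℕ) : ℤ)) {c : Eˣ}
    (hc : ∀ n, s (n + 1) = c * s n) : M = Subgroup.closure {c} := by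
  have hgeo := eq_zpow_mul_of_succ_eq_mul c.ne_zero hc
  refine Subgroup.eq_closure_of_injective hm hcard hinj ?_ fun d hd => ?_
  · rw [Set.singleton_subset_iff]
    refine Subgroup.mem_of_pow_card_eq_one hm hcard (Units.ext ?_)
    have hm0 : s m = s 0 := by simpa using hper 0
    simpa [hm0, hs0] using (hgeo m).symm
  · rw [hgeo, zpow_natCast, ← Units.val_pow_eq_pow_val, hd c rfl, Units.val_one, one_mul]

/-- Let `f = (x - a)(x - b) ∈ F[x]` with `a ≠ b` and `a, b ≠ 0`. If `M` is an `f`-subgroup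
of order `m` in the multiplicative group of an extension `E` of `F` (presented by the
`f`-sequence `s`), then `M` is one of `⟨a, b⟩`, `⟨a⟩`, `⟨b⟩`; moreover, if `M` is a proper
subgroup of `⟨a, b⟩`, then every `f`-sequence presenting `M` is cyclic (hence `M` is a
standard `f`-subgroup). -/
theorem quadratic_fSubgroup_classification {F E : Type*} [Field F] [Field E] [Algebra F E]
    (a b : F) (ha : a ≠ 0) (hb : b ≠ 0) (hab : a ≠ b)
    (f : Polynomial F) (hf : f = (X - C a) * (X - C b))
    (M : Subgroup Eˣ) (m : ℕ) (hm : 0 < m) (hcard : Nat.card M = m)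
    (s : ℤ → E)
    (hseq : lrsApply (f.map (algebraMap F E)) s = 0)
    (hper : ∀ n : ℤ, s (n + m) = s n)
    (hinj : Function.Injective fun i : Fin m => s ((i : ℕ) : ℤ))
    (hrange : (Set.range fun i : Fin m => s ((i : ℕ) : ℤ)) = ((↑) : Eˣ → E) '' M)
    (ua ub : Eˣ) (hua : (ua : E) = algebraMap F E a) (hub : (ub : E) = algebraMap F E b) :
    (M = Subgroup.closure {ua, ub} ∨ M = Subgroup.closure {ua} ∨ M = Subgroup.closure {ub}) ∧
    (M < Subgroup.closure {ua, ub} →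
      ∀ s' : ℤ → E,
        lrsApply (f.map (algebraMap F E)) s' = 0 →
        (∀ n : ℤ, s' (n + m) = s' n) →
        (Function.Injective fun i : Fin m => s' ((i : ℕ) : ℤ)) →
        ((Set.range fun i : Fin m => s' ((i : ℕ) : ℤ)) = ((↑) : Eˣ → E) '' M) →
        ∃ c : E, ∀ n : ℤ, s' (n + 1) = c * s' n) := by
  have hua0 := hua ▸ ua.ne_zero
  have hub0 := hub ▸ ub.ne_zero
  have hab' : algebraMap F E a ≠ algebraMap F E b := (algebraMap F E).injective.ne hab
  have hfmap : f.map (algebraMap F E) =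
      (X - C (algebraMap F E a)) * (X - C (algebraMap F E b)) := by
    simp [hf]
  rw [hfmap] at hseq ⊢
  have hmem : ∀ {c : Eˣ}, (c : E) ^ m = 1 → c ∈ M := fun hc =>
    Subgroup.mem_of_pow_card_eq_one hm hcard (Units.ext (by simpa using hc))
  constructor
  · have hs0 : s 0 ≠ 0 := by
      have h0 : s 0 ∈ ((↑) : Eˣ → E) '' M := hrange ▸ ⟨⟨0, hm⟩, rfl⟩
      obtain ⟨x, -, hx⟩ := h0
      exact hx ▸ x.ne_zero
    obtain h | h | ⟨ham, hbm, hd⟩ :=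
      geometric_or_pow_eq_one_of_lrsApply_eq_zero hua0 hub0 hab' hseq hper
    · exact .inr <| .inl <|
        Subgroup.eq_closure_singleton_of_geometric hm hcard hs0 hper hinj (by rwa [hua])
    · exact .inr <| .inr <|
        Subgroup.eq_closure_singleton_of_geometric hm hcard hs0 hper hinj (by rwa [hub])
    · refine .inl <| Subgroup.eq_closure_of_injective hm hcard hinj ?_ fun d h => hd d ?_ ?_
      · exact Set.pair_subset (hmem (by rwa [hua])) (hmem (by rwa [hub]))
      · rw [← hua, ← Units.val_pow_eq_pow_val, h ua (by simp), Units.val_one]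
      · rw [← hub, ← Units.val_pow_eq_pow_val, h ub (by simp), Units.val_one]
  · intro hlt s' hseq' hper' _ _
    obtain h | h | ⟨ham, hbm, -⟩ :=
      geometric_or_pow_eq_one_of_lrsApply_eq_zero hua0 hub0 hab' hseq' hper'
    · exact ⟨_, h⟩
    · exact ⟨_, h⟩
    · exact absurd ((Subgroup.closure_le M).mpr
        (Set.pair_subset (hmem (by rwa [hua])) (hmem (by rwa [hub])))) hlt.not_ge
end

section
/- Let E be a field and let M be a finite multiplicative subgroup of E^* whose order m = r^e is a power of a prime r with m > 1. Then M is never automatically non-standard: there is no polynomial f ∈ E[x] dividing (x^m − 1)/((x − 1)·Φ_m(x)) such that M is an f-subgroup, where Φ_m is the m-th cyclotomic polynomial over E. -/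
open Polynomial

theorem funLeft_shift_pow_apply {F : Type*} [CommRing F] (s : ℤ → F) (k : ℕ) (n : ℤ) :
    ((LinearMap.funLeft F F fun n : ℤ => n + 1) ^ k) s n = s (n + k) := by
  induction k generalizing n with
  | zero => simp
  | succ k ih =>
    rw [pow_succ', Module.End.mul_apply, LinearMap.funLeft_apply, ih]
    congr 1
    push_cast
    ring

theorem lrsApply_eq_aeval_s14 {F : Type*} [CommRing F] (f : Polynomial F) (s : ℤ → F) :
    lrsApply f s = aeval (LinearMap.funLeft F F fun n : ℤ => n + 1) f s := by
  ext n
  simp [lrsApply, aeval_eq_sum_range, LinearMap.sum_apply, funLeft_shift_pow_apply]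

/-- A sequence annihilated by a divisor of `X ^ k - 1` has period `k`. -/
theorem periodic_of_lrsApply_eq_zero {F : Type*} [CommRing F] {f : Polynomial F} {s : ℤ → F}
    {k : ℕ} (hf : f ∣ X ^ k - 1) (hs : lrsApply f s = 0) (n : ℤ) : s (n + k) = s n := by
  obtain ⟨g, hg⟩ := hf
  rw [lrsApply_eq_aeval_s14] at hs
  have h : aeval (LinearMap.funLeft F F fun n : ℤ => n + 1) (X ^ k - 1 : Polynomial F) s = 0 := by
    rw [hg, mul_comm, map_mul, Module.End.mul_apply, hs, map_zero]
  have h' := congrFun h n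
  simpa [funLeft_shift_pow_apply, sub_eq_zero] using h'

theorem X_pow_sub_one_div_dvd {F : Type*} [Field F] {r : ℕ} (hr : r.Prime) (k : ℕ) :
    (X ^ r ^ (k + 1) - 1) / ((X - 1) * cyclotomic (r ^ (k + 1)) F) ∣ (X ^ r ^ k - 1 : F[X]) := by
  have := Fact.mk hr
  obtain ⟨q, hq⟩ : (X - 1 : F[X]) ∣ X ^ r ^ k - 1 := sub_one_dvd_pow_sub_one X (r ^ k)
  have h0 : (X - 1) * cyclotomic (r ^ (k + 1)) F ≠ 0 :=
    mul_ne_zero (by simpa using X_sub_C_ne_zero (1 : F)) (cyclotomic_ne_zero _ _)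
  have h : (X ^ r ^ (k + 1) - 1 : F[X]) = (X - 1) * cyclotomic (r ^ (k + 1)) F * q := by
    rw [← cyclotomic_prime_pow_mul_X_pow_sub_one F r k, hq]
    ring
  rw [h, mul_div_cancel_left₀ _ h0, hq]
  exact dvd_mul_left _ _

/-- A finite multiplicative subgroup `M` of `E^*` of prime-power order `m = r^e > 1`
is never automatically non-standard: there is no `f ∈ E[x]` dividing
`(x^m - 1)/((x - 1)·Φ_m(x))` together with an `f`-sequence of period `m` presenting `M`. -/
theorem no_automatically_nonstandard_of_prime_power_order {E : Type*} [Field E]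
    (M : Subgroup Eˣ) (r e m : ℕ) (hr : r.Prime) (hme : m = r ^ e) (hm : 1 < m)
    (hcard : Nat.card M = m) :
    ¬∃ (f : Polynomial E) (s : ℤ → E),
        f ∣ (X ^ m - 1) / ((X - 1) * cyclotomic m E) ∧
        lrsApply f s = 0 ∧
        (∀ n : ℤ, s (n + m) = s n) ∧
        (Function.Injective fun i : Fin m => s ((i : ℕ) : ℤ)) ∧
        (Set.range fun i : Fin m => s ((i : ℕ) : ℤ)) = ((↑) : Eˣ → E) '' M := by
  rintro ⟨f, s, hf, hs, -, hinj, -⟩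
  obtain ⟨k, rfl⟩ : ∃ k, e = k + 1 := by
    refine Nat.exists_eq_succ_of_ne_zero ?_
    rintro rfl
    simp [hme] at hm
  have hlt : r ^ k < m := hme ▸ Nat.pow_lt_pow_right hr.one_lt k.lt_succ_self
  rw [hme] at hf
  have hper := periodic_of_lrsApply_eq_zero (hf.trans (X_pow_sub_one_div_dvd hr k)) hs 0
  have heq := @hinj ⟨r ^ k, hlt⟩ ⟨0, by omega⟩ (by simpa using hper)
  exact (pow_pos hr.pos k).ne' (congrArg Fin.val heq)
end

section
/- Let E be a field of characteristic p and suppose M is an automatically non-standard f-subgroup of order m > 1 in E^*, i.e., f ∈ E[x] divides (x^m − 1)/((x − 1)·Φ_m(x)) and there is an f-sequence of period m presenting M. Let L be any finite multiplicative subgroup of E^* with M ≤ L, and write |L| = k·m. Then L is an automatically non-standard g-subgroup for g(x) = f(x^k): the polynomial g divides (x^{km} − 1)/((x − 1)·Φ_{km}(x)) and there exists a g-sequence of period km presenting L. -/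
open Polynomial

theorem lrsApply_eq_sum {F : Type*} [CommRing F] (f : Polynomial F) (s : ℤ → F) (n : ℤ) :
    lrsApply f s n = f.sum fun i a => a * s (n + i) := by
  rw [sum_over_range _ fun i => zero_mul _, lrsApply]

theorem lrsApply_expand {F : Type*} [CommRing F] (f : Polynomial F) (k : ℕ) (t : ℤ → F)
    (n : ℤ) :
    lrsApply (expand F k f) t n = f.sum fun i a => a * t (n + (i * k : ℕ)) := by
  rw [lrsApply_eq_sum]
  induction f using Polynomial.induction_on' with
  | add p q hp hq =>
    rw [map_add, sum_add_index _ _ _ (by simp) (by intros; ring), hp, hq,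
      sum_add_index _ _ _ (by simp) (by intros; ring)]
  | monomial i a =>
    rw [expand_monomial, sum_monomial_index _ _ (by simp), sum_monomial_index _ _ (by simp)]

/-- Interleaving `k` scaled copies of an `f`-sequence gives an `f(x^k)`-sequence. -/
theorem lrsApply_expand_interleave {F : Type*} [CommRing F] {f : Polynomial F} {s : ℤ → F}
    (hs : lrsApply f s = 0) {k : ℕ} (hk : k ≠ 0) (c : ℤ → F) :
    lrsApply (expand F k f) (fun n => c (n % k) * s (n / k)) = 0 := by
  have hk' : (k : ℤ) ≠ 0 := by exact_mod_cast hk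
  funext n
  have h := congrFun hs (n / k)
  rw [lrsApply_eq_sum] at h
  rw [lrsApply_expand]
  simp only [Nat.cast_mul, Int.add_mul_emod_self_right, Int.add_mul_ediv_right _ _ hk']
  simp only [Polynomial.sum, Pi.zero_apply] at h ⊢
  rw [← mul_zero (c (n % k)), ← h, Finset.mul_sum]
  exact Finset.sum_congr rfl fun i _ => by ring

theorem cyclotomic_mul_dvd_expand_cyclotomic (R : Type*) [CommRing R] {k m : ℕ} (hk : 0 < k)
    (hm : 0 < m) : cyclotomic (k * m) R ∣ expand R k (cyclotomic m R) := by
  have hkm : 0 < k * m := Nat.mul_pos hk hm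
  suffices h : cyclotomic (k * m) ℤ ∣ expand ℤ k (cyclotomic m ℤ) by
    simpa [map_expand] using Polynomial.map_dvd (Int.castRingHom R) h
  have hζ := Complex.isPrimitiveRoot_exp (k * m) hkm.ne'
  rw [cyclotomic_eq_minpoly hζ hkm]
  refine minpoly.isIntegrallyClosed_dvd (hζ.isIntegral hkm) ?_
  rw [expand_aeval, aeval_def, ← eval_map, algebraMap_int_eq, map_cyclotomic_int]
  exact (hζ.pow hkm rfl).isRoot_cyclotomic hm

theorem X_sub_one_mul_cyclotomic_dvd (R : Type*) [CommRing R] {m : ℕ} (hm : 1 < m) :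
    (X - 1) * cyclotomic m R ∣ X ^ m - 1 := by
  rw [← prod_cyclotomic_eq_X_pow_sub_one (by omega : 0 < m), ← cyclotomic_one R,
    ← Finset.prod_pair (f := fun i => cyclotomic i R) hm.ne]
  refine Finset.prod_dvd_prod_of_subset _ _ _ fun i hi => ?_
  rcases Finset.mem_insert.1 hi with rfl | hi
  · simp; omega
  · rw [Finset.mem_singleton.1 hi]; simp; omega

theorem X_sub_one_mul_cyclotomic_ne_zero (R : Type*) [CommRing R] [IsDomain R] (m : ℕ) :
    (X - 1) * cyclotomic m R ≠ 0 :=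
  mul_ne_zero (by simpa using X_sub_C_ne_zero (1 : R)) (cyclotomic_ne_zero m R)

theorem expand_dvd_of_dvd_X_pow_sub_one_div {E : Type*} [Field E] {m k : ℕ} (hm : 1 < m)
    (hk : 0 < k) {f : Polynomial E} (hf : f ∣ (X ^ m - 1) / ((X - 1) * cyclotomic m E)) :
    expand E k f ∣ (X ^ (k * m) - 1) / ((X - 1) * cyclotomic (k * m) E) := by
  obtain ⟨h, hh⟩ := hf
  have key : (X ^ m - 1 : Polynomial E) = (X - 1) * cyclotomic m E * (f * h) := by
    rw [← hh, EuclideanDomain.mul_div_cancel' (X_sub_one_mul_cyclotomic_ne_zero E m)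
      (X_sub_one_mul_cyclotomic_dvd E hm)]
  have key' := congrArg (expand E k) key
  simp only [map_mul, map_sub, map_pow, map_one, expand_X, ← pow_mul] at key'
  obtain ⟨a, ha⟩ := cyclotomic_mul_dvd_expand_cyclotomic E hk (by omega : 0 < m)
  obtain ⟨b, hb⟩ := sub_one_dvd_pow_sub_one (X : Polynomial E) k
  refine ⟨a * b * expand E k h, ?_⟩
  refine (EuclideanDomain.eq_div_of_mul_eq_right (X_sub_one_mul_cyclotomic_ne_zero E _) ?_).symm
  rw [key', ha, hb]
  ring

/-- A subgroup of order `k * m` containing a subgroup of order `m` is covered by `k` cosets. -/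
theorem exists_coset_representatives {G : Type*} [Group G] {M L : Subgroup G} (hML : M ≤ L)
    {k m : ℕ} (hm : 0 < m) (hk : 0 < k) (hM : Nat.card M = m) (hL : Nat.card L = k * m) :
    ∃ c : ℕ → G, (∀ j, c j ∈ L) ∧ ∀ x ∈ L, ∃ j < k, (c j)⁻¹ * x ∈ M := by
  have hidx : Nat.card (L ⧸ M.subgroupOf L) = k := by
    have h := Subgroup.card_eq_card_quotient_mul_card_subgroup (M.subgroupOf L)
    rw [hL, Nat.card_congr (Subgroup.subgroupOfEquivOfLe hML).toEquiv, hM] at h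
    exact (Nat.eq_of_mul_eq_mul_right hm h).symm
  have : Finite (L ⧸ M.subgroupOf L) := Nat.finite_of_card_ne_zero (by omega)
  let e := Finite.equivFinOfCardEq hidx
  refine ⟨fun j => if h : j < k then ((e.symm ⟨j, h⟩).out : L) else 1, fun j => ?_,
    fun x hx => ⟨e (QuotientGroup.mk ⟨x, hx⟩), (e _).2, ?_⟩⟩
  · dsimp only
    split_ifs
    · exact SetLike.coe_mem _
    · exact L.one_mem
  · simp only [Fin.is_lt, dif_pos, Fin.eta, Equiv.symm_apply_apply]
    exact Subgroup.mem_subgroupOf.1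
      (QuotientGroup.eq.1 (Quotient.out_eq' (QuotientGroup.mk (s := M.subgroupOf L) ⟨x, hx⟩)))

/-- A sequence whose first `n` terms exhaust a finite set with `n` elements has these terms
pairwise distinct. -/
theorem injective_of_range_eq {α : Type*} {n : ℕ} {t : Fin n → α} {S : Set α}
    (h : Set.range t = S) (hS : S.ncard = n) : Function.Injective t := by
  rw [← Set.injOn_univ]
  refine Set.injOn_of_ncard_image_eq ?_
  rw [Set.image_univ, h, hS, Set.ncard_univ, Nat.card_fin]

/-- Extension theorem: if `M` is an automatically non-standard `f`-subgroup of order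
`m > 1` in `E^*` (i.e., `f ∣ (x^m - 1)/((x - 1)·Φ_m)` and some `f`-sequence `s` of
period `m` presents `M`), and `L` is a finite multiplicative subgroup of `E^*` containing
`M` with `|L| = k·m`, then `L` is an automatically non-standard `g`-subgroup for
`g(x) = f(x^k)`: `g` divides `(x^{km} - 1)/((x - 1)·Φ_{km})` and some `g`-sequence of
period `km` presents `L`. -/
theorem extension_of_automatically_nonstandard {E : Type*} [Field E]
    (m : ℕ) (hm : 1 < m)
    (f : Polynomial E) (M : Subgroup Eˣ) (hcardM : Nat.card M = m)
    (hfdvd : f ∣ (X ^ m - 1) / ((X - 1) * cyclotomic m E))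
    (s : ℤ → E)
    (hseq : lrsApply f s = 0)
    (hper : ∀ n : ℤ, s (n + m) = s n)
    (hinj : Function.Injective fun i : Fin m => s ((i : ℕ) : ℤ))
    (hrange : (Set.range fun i : Fin m => s ((i : ℕ) : ℤ)) = ((↑) : Eˣ → E) '' M)
    (L : Subgroup Eˣ) (hML : M ≤ L) (k : ℕ) (hk : 0 < k) (hcardL : Nat.card L = k * m) :
    (f.comp (X ^ k)) ∣ (X ^ (k * m) - 1) / ((X - 1) * cyclotomic (k * m) E) ∧
    ∃ t : ℤ → E,
      lrsApply (f.comp (X ^ k)) t = 0 ∧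
      (∀ n : ℤ, t (n + (k * m : ℕ)) = t n) ∧
      (Function.Injective fun i : Fin (k * m) => t ((i : ℕ) : ℤ)) ∧
      (Set.range fun i : Fin (k * m) => t ((i : ℕ) : ℤ)) = ((↑) : Eˣ → E) '' L := by
  have hk' : (k : ℤ) ≠ 0 := by exact_mod_cast hk.ne'
  rw [← expand_eq_comp_X_pow]
  refine ⟨expand_dvd_of_dvd_X_pow_sub_one_div hm hk hfdvd, ?_⟩
  obtain ⟨c, hcL, hc⟩ := exists_coset_representatives hML (by omega) hk hcardM hcardL
  have hsM : ∀ i < m, ∃ u ∈ M, (u : E) = s i := fun i hi => by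
    have h : s i ∈ Set.range fun i : Fin m => s ((i : ℕ) : ℤ) := ⟨⟨i, hi⟩, rfl⟩
    rwa [hrange] at h
  have hran : (Set.range fun i : Fin (k * m) =>
      (c (((i : ℕ) : ℤ) % k).toNat : E) * s (((i : ℕ) : ℤ) / k)) = ((↑) : Eˣ → E) '' L := by
    ext y
    constructor
    · rintro ⟨i, rfl⟩
      obtain ⟨u, hu, hus⟩ := hsM (i / k) (Nat.div_lt_of_lt_mul i.2)
      refine ⟨_, L.mul_mem (hcL (((i : ℕ) : ℤ) % k).toNat) (hML hu), ?_⟩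
      rw [Units.val_mul, hus, Int.natCast_div]
    · rintro ⟨x, hx, rfl⟩
      obtain ⟨j, hj, hjM⟩ := hc x hx
      obtain ⟨i, hi⟩ : ((((c j)⁻¹ * x : Eˣ)) : E) ∈
          Set.range fun i : Fin m => s ((i : ℕ) : ℤ) := hrange ▸ ⟨_, hjM, rfl⟩
      have hlt : j + k * i < k * m := by nlinarith [i.2]
      refine ⟨⟨j + k * i, hlt⟩, ?_⟩
      dsimp only at hi ⊢
      rw [← Int.natCast_mod, ← Int.natCast_div, Int.toNat_natCast, Nat.add_mul_mod_self_left,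
        Nat.mod_eq_of_lt hj, Nat.add_mul_div_left _ _ hk, Nat.div_eq_of_lt hj, zero_add, hi]
      simp
  refine ⟨fun n => (c (n % k).toNat : E) * s (n / k),
    lrsApply_expand_interleave hseq hk.ne' fun n => (c n.toNat : E), fun n => ?_,
    injective_of_range_eq hran ?_, hran⟩
  · simp only [Nat.cast_mul, Int.add_mul_emod_self_left, Int.add_mul_ediv_left _ _ hk', hper]
  · rw [Set.ncard_image_of_injective _ Units.val_injective, ← hcardL]
    rfl
end

section
/- Let F be a field and let M be a finite multiplicative subgroup of F^* of order m ≥ 4, and let f(x) = x^{m−1} + x^{m−2} + ⋯ + x + 1 = (x^m − 1)/(x − 1) ∈ F[x]. Then: (a) every period-m sequence s : ℤ → F whose values s_0, s_1, …, s_{m−1} are pairwise distinct and enumerate M satisfies f(σ)s = 0, i.e., is an f-sequence presenting M; and (b) there exists such a presenting f-sequence that is not cyclic. Hence M is a non-standard f-subgroup. -/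
open Polynomial

theorem lrsApply_geom_sum {F : Type*} [Field F] {m : ℕ} (hm : 0 < m) (s : ℤ → F) (n : ℤ) :
    lrsApply (∑ i ∈ Finset.range m, (X : Polynomial F) ^ i) s n =
      ∑ i ∈ Finset.range m, s (n + i) := by
  have hdeg : (∑ i ∈ Finset.range m, (X : Polynomial F) ^ i).natDegree < m := by
    refine lt_of_le_of_lt (natDegree_sum_le_of_forall_le (n := m - 1) _ _ fun i hi => ?_)
      (Nat.sub_lt hm one_pos)
    rw [natDegree_X_pow]
    have := Finset.mem_range.mp hi
    omega
  unfold lrsApply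
  rw [← sum_over_range _ (f := fun i a => a * s (n + i)) (by simp),
    sum_over_range' _ (by simp) m hdeg]
  refine Finset.sum_congr rfl fun i hi => ?_
  simp [coeff_X_pow, Finset.mem_range.mp hi]

theorem sum_range_add_eq_of_periodic {A : Type*} [AddCommGroup A] {m : ℕ} {s : ℤ → A}
    (hs : ∀ n : ℤ, s (n + m) = s n) (n : ℤ) :
    ∑ i ∈ Finset.range m, s (n + i) = ∑ i ∈ Finset.range m, s i := by
  have step : ∀ k : ℤ, ∑ i ∈ Finset.range m, s (k + 1 + i) = ∑ i ∈ Finset.range m, s (k + i) := by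
    intro k
    have h := (Finset.sum_range_succ' (fun i : ℕ => s (k + i)) m).symm.trans
      (Finset.sum_range_succ _ m)
    simp only [hs, Nat.cast_zero, add_zero, add_left_inj] at h
    rw [← h]
    refine Finset.sum_congr rfl fun i _ => ?_
    push_cast
    congr 1
    ring
  induction n using Int.induction_on with
  | zero => simp
  | succ k ih => rw [step, ih]
  | pred k ih => rw [← ih, ← step, sub_add_cancel]

theorem sum_range_eq_zero_of_range_eq_subgroup {F : Type*} [Field F] {M : Subgroup Fˣ}
    (hM : M ≠ ⊥) {m : ℕ} {s : ℤ → F} (hinj : Function.Injective fun i : Fin m => s ((i : ℕ) : ℤ))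
    (hrange : (Set.range fun i : Fin m => s ((i : ℕ) : ℤ)) = ((↑) : Fˣ → F) '' M) :
    ∑ i ∈ Finset.range m, s i = 0 := by
  have hfin : Finite M := by
    have : (((↑) : Fˣ → F) '' (M : Set Fˣ)).Finite := hrange ▸ Set.finite_range _
    exact (this.of_finite_image Units.val_injective.injOn).to_subtype
  have := Fintype.ofFinite M
  let u : Fin m → ((↑) : Fˣ → F) '' (M : Set Fˣ) := fun i => ⟨s ((i : ℕ) : ℤ), hrange ▸ ⟨i, rfl⟩⟩
  have hu : Function.Bijective u := by
    refine ⟨fun i j h => hinj (congrArg Subtype.val h), fun ⟨y, hy⟩ => ?_⟩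
    obtain ⟨i, hi⟩ := hrange.symm ▸ hy
    exact ⟨i, Subtype.ext hi⟩
  let e : Fin m ≃ M :=
    (Equiv.ofBijective u hu).trans (Equiv.Set.image _ (M : Set Fˣ) Units.val_injective).symm
  have he : ∀ i, ((e i : Fˣ) : F) = s ((i : ℕ) : ℤ) := fun i =>
    congrArg Subtype.val
      ((Equiv.Set.image _ (M : Set Fˣ) Units.val_injective).apply_symm_apply (u i))
  rw [Finset.sum_range fun i : ℕ => s (i : ℤ), ← FiniteField.sum_subgroup_units_eq_zero hM]
  exact Fintype.sum_equiv e _ _ fun i => (he i).symm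

/-- The `m`-periodic extension to `ℤ` of a sequence indexed by `Fin m`. -/
def periodicExtension {α : Type*} {m : ℕ} (hm : 0 < m) (v : Fin m → α) (n : ℤ) : α :=
  v ⟨(n % m).toNat, by have := Int.emod_lt_of_pos n (Int.natCast_pos.mpr hm); omega⟩

theorem periodicExtension_add {α : Type*} {m : ℕ} (hm : 0 < m) (v : Fin m → α) (n : ℤ) :
    periodicExtension hm v (n + m) = periodicExtension hm v n := by
  simp [periodicExtension]

theorem periodicExtension_natCast {α : Type*} {m : ℕ} (hm : 0 < m) (v : Fin m → α) {i : ℕ}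
    (hi : i < m) : periodicExtension hm v i = v ⟨i, hi⟩ := by
  unfold periodicExtension
  congr 2
  rw [← Int.natCast_mod, Nat.mod_eq_of_lt hi, Int.toNat_natCast]

/-- Interchanging the third and fourth values destroys cyclicity. -/
theorem exists_equiv_periodicExtension_not_cyclic {F : Type*} [Field F] {M : Subgroup Fˣ} {m : ℕ}
    (hm : 4 ≤ m) (hcard : Nat.card M = m) :
    ∃ e : Fin m ≃ M, ¬∃ c : F, ∀ n : ℤ,
      periodicExtension (by omega) (fun i => ((e i : Fˣ) : F)) (n + 1) =
        c * periodicExtension (by omega) (fun i => ((e i : Fˣ) : F)) n := by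
  have hm0 : 0 < m := by omega
  have : Finite M := Nat.finite_of_card_ne_zero (by omega)
  let e : Fin m ≃ M := (Finite.equivFinOfCardEq hcard).symm
  have key : ∀ e : Fin m ≃ M, (∃ c : F, ∀ n : ℤ,
      periodicExtension hm0 (fun i => ((e i : Fˣ) : F)) (n + 1) =
        c * periodicExtension hm0 (fun i => ((e i : Fˣ) : F)) n) →
      (e ⟨1, by omega⟩ : M) * e ⟨1, by omega⟩ = e ⟨0, by omega⟩ * e ⟨2, by omega⟩ := by
    rintro e ⟨c, hc⟩
    have h0 := hc (0 : ℕ)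
    have h1 := hc (1 : ℕ)
    rw [← Nat.cast_succ, periodicExtension_natCast hm0 _ (by omega),
      periodicExtension_natCast hm0 _ (by omega)] at h0 h1
    apply Subtype.ext
    apply Units.ext
    push_cast
    rw [h1, h0]
    ring
  by_contra! hcyc
  have h := key e (hcyc e)
  have h' := key ((Equiv.swap ⟨2, by omega⟩ ⟨3, by omega⟩).trans e) (hcyc _)
  simp only [Equiv.trans_apply, Equiv.swap_apply_left] at h'
  rw [Equiv.swap_apply_of_ne_of_ne (by simp) (by simp),
    Equiv.swap_apply_of_ne_of_ne (by simp) (by simp), h] at h'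
  simpa using e.injective (mul_left_cancel h')

/-- Every finite multiplicative subgroup `M ≤ F^*` of order `m ≥ 4` is a non-standard
`f`-subgroup for `f(x) = x^{m-1} + ⋯ + x + 1`: (a) every period-`m` sequence whose first
`m` values are pairwise distinct and enumerate `M` is an `f`-sequence presenting `M`;
and (b) some such presenting `f`-sequence is not cyclic. -/
theorem every_subgroup_nonstandard_for_all_ones_polynomial {F : Type*} [Field F]
    (M : Subgroup Fˣ) (m : ℕ) (hm : 4 ≤ m) (hcard : Nat.card M = m) :
    (∀ s : ℤ → F,
      (∀ n : ℤ, s (n + m) = s n) →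
      (Function.Injective fun i : Fin m => s ((i : ℕ) : ℤ)) →
      ((Set.range fun i : Fin m => s ((i : ℕ) : ℤ)) = ((↑) : Fˣ → F) '' M) →
      lrsApply (∑ i ∈ Finset.range m, (X : Polynomial F) ^ i) s = 0) ∧
    ∃ s : ℤ → F,
      (∀ n : ℤ, s (n + m) = s n) ∧
      (Function.Injective fun i : Fin m => s ((i : ℕ) : ℤ)) ∧
      ((Set.range fun i : Fin m => s ((i : ℕ) : ℤ)) = ((↑) : Fˣ → F) '' M) ∧
      lrsApply (∑ i ∈ Finset.range m, (X : Polynomial F) ^ i) s = 0 ∧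
      ¬∃ c : F, ∀ n : ℤ, s (n + 1) = c * s n := by
  have hM : M ≠ ⊥ := by
    rintro rfl
    rw [Subgroup.card_bot] at hcard
    omega
  have hm0 : 0 < m := by omega
  have present : ∀ s : ℤ → F,
      (∀ n : ℤ, s (n + m) = s n) →
      (Function.Injective fun i : Fin m => s ((i : ℕ) : ℤ)) →
      ((Set.range fun i : Fin m => s ((i : ℕ) : ℤ)) = ((↑) : Fˣ → F) '' M) →
      lrsApply (∑ i ∈ Finset.range m, (X : Polynomial F) ^ i) s = 0 := by
    intro s hper hinj hrange
    funext n
    rw [lrsApply_geom_sum hm0, sum_range_add_eq_of_periodic hper,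
      sum_range_eq_zero_of_range_eq_subgroup hM hinj hrange, Pi.zero_apply]
  obtain ⟨e, he⟩ := exists_equiv_periodicExtension_not_cyclic hm hcard
  have hper := periodicExtension_add hm0 fun i => ((e i : Fˣ) : F)
  have hval : (fun i : Fin m => periodicExtension hm0 (fun i => ((e i : Fˣ) : F)) ((i : ℕ) : ℤ)) =
      fun i => ((e i : Fˣ) : F) := funext fun i => periodicExtension_natCast hm0 _ i.isLt
  have hinj : Function.Injective fun i : Fin m => ((e i : Fˣ) : F) :=
    Units.val_injective.comp (Subtype.val_injective.comp e.injective)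
  have hrange : (Set.range fun i : Fin m => ((e i : Fˣ) : F)) = ((↑) : Fˣ → F) '' M := by
    ext y
    constructor
    · rintro ⟨i, rfl⟩
      exact ⟨e i, (e i).2, rfl⟩
    · rintro ⟨x, hx, rfl⟩
      exact ⟨e.symm ⟨x, hx⟩, by simp⟩
  rw [← hval] at hinj hrange
  exact ⟨present, _, hper, hinj, hrange, present _ hper hinj hrange, he⟩
end
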